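/- arXiv:1507.01329 — 2 statements merged into one kernel-verified Lean document; each statement's English description precedes it below -/
import Mathlib

section
/- The symmetric algebra S(S²(ℂ^N)) over the space of symmetric N×N matrices decomposes under GL_N multiplicity-freely as ⊕_λ L_λ, where λ runs over all even partitions of length ≤ N. Equivalently, as an identity of symmetric functions: ∏_{i≤j} (1 - x_i x_j)^{-1} = ∑_{λ even} s_λ(x_1,…,x_N). -/
open MvPolynomial

/-- Complete homogeneous symmetric polynomial indexed by an integer (zero for negative index). -/
noncomputable def hpolyZ (σ : Type*) [Fintype σ] [DecidableEq σ] (d : ℤ) : MvPolynomial σ ℂ :=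
  if 0 ≤ d then hsymm σ ℂ d.toNat else 0

/-- Schur polynomial of a partition given as a (weakly decreasing) list of parts, defined by
the Jacobi–Trudi formula `s_λ = det (h_{λ_i - i + j})`. -/
noncomputable def schurPoly (σ : Type*) [Fintype σ] [DecidableEq σ] (l : List ℕ) :
    MvPolynomial σ ℂ :=
  Matrix.det (Matrix.of fun i j : Fin l.length =>
    hpolyZ σ ((l.get i : ℤ) - (i : ℤ) + (j : ℤ)))

/-- The sorted (decreasing) list of parts of a partition. -/
noncomputable def partsList {n : ℕ} (p : Nat.Partition n) : List ℕ := p.parts.sort (· ≥ ·)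

section

open Finset Matrix

/-- The alternant with the `i`-th exponent equal to `f i + i`. -/
def alternant {R : Type*} [CommRing R] {N : ℕ} (f : Fin N → ℕ) (x : Fin N → R) : R :=
  Matrix.det (Matrix.of fun i j : Fin N => x j ^ (f i + i))

theorem alternant_zero {R : Type*} [CommRing R] {N : ℕ} (x : Fin N → R) :
    alternant 0 x = (vandermonde x).det := by
  rw [← det_transpose]
  simp [alternant, vandermonde, transpose]

theorem alternant_add_const {R : Type*} [CommRing R] {N : ℕ} (f : Fin N → ℕ) (c : ℕ)
    (x : Fin N → R) :
    alternant (fun i => f i + c) x = (∏ k, x k) ^ c * alternant f x := by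
  rw [alternant, alternant, ← prod_pow, ← det_mul_row]
  congr 1
  ext i j
  simp only [of_apply]
  ring

/-- Laplace expansion of a determinant whose first row is arbitrary and whose other rows are those
of an alternant. -/
theorem det_cons_alternant {R : Type*} [CommRing R] {N : ℕ} (f : Fin N → ℕ)
    (r x : Fin (N + 1) → R) :
    Matrix.det (Matrix.of (Fin.cons r fun i j => x j ^ (f i + (i + 1)))) =
      ∑ j : Fin (N + 1), (-1) ^ (j : ℕ) * r j *
        ((∏ k, x (j.succAbove k)) * alternant f (x ∘ j.succAbove)) := by
  rw [det_succ_row_zero]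
  refine sum_congr rfl fun j _ => ?_
  congr 1
  rw [alternant, ← det_mul_row]
  congr 1
  ext i k
  simp [pow_add, pow_succ]
  ring

theorem alternant_cons_zero {R : Type*} [CommRing R] {N : ℕ} (f : Fin N → ℕ)
    (x : Fin (N + 1) → R) :
    alternant (Fin.cons 0 f : Fin (N + 1) → ℕ) x =
      ∑ j : Fin (N + 1), (-1) ^ (j : ℕ) *
        ((∏ k, x (j.succAbove k)) * alternant f (x ∘ j.succAbove)) := by
  have := det_cons_alternant f (fun _ => 1) x
  simp only [mul_one] at this
  rw [← this, alternant]
  congr 1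
  ext i j
  refine Fin.cases ?_ (fun i => ?_) i <;> simp

theorem sum_pow_mul_vandermonde {R : Type*} [CommRing R] {N : ℕ} (x : Fin (N + 1) → R) {m : ℕ}
    (hm : m ≤ N + 1) :
    ∑ j : Fin (N + 1), (-1) ^ (j : ℕ) * x j ^ m *
        ((∏ k, x (j.succAbove k)) * alternant 0 (x ∘ j.succAbove)) =
      if m = 0 then alternant 0 x
      else if m = N + 1 then (-1) ^ N * (∏ k, x k) * alternant 0 x else 0 := by
  rw [← det_cons_alternant 0 (fun j => x j ^ m) x]
  split_ifs with h0 h1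
  · subst h0
    rw [alternant]
    congr 1
    ext i j
    refine Fin.cases ?_ (fun i => ?_) i <;> simp
  · have h := alternant_add_const 0 1 x
    rw [pow_one] at h
    rw [mul_assoc, ← h, alternant]
    have hs := det_permute (finRotate (N + 1)).symm
      (Matrix.of fun i j : Fin (N + 1) => x j ^ ((0 : Fin (N + 1) → ℕ) i + 1 + i))
    rw [Equiv.Perm.sign_symm, sign_finRotate] at hs
    simp only [add_tsub_cancel_right, Units.val_pow_eq_pow_val, Units.val_neg, Units.val_one,
      Int.cast_pow, Int.cast_neg, Int.cast_one] at hs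
    rw [← hs]
    congr 1
    ext i j
    refine Fin.cases ?_ (fun i => ?_) i
    · have : (finRotate (N + 1)).symm 0 = Fin.last N := by
        rw [Equiv.symm_apply_eq, finRotate_last]
      simp [this, h1, add_comm]
    · have : (finRotate (N + 1)).symm i.succ = i.castSucc := by
        rw [Equiv.symm_apply_eq]; simp
      simp [this, add_comm]
  · obtain ⟨m, rfl⟩ := Nat.exists_eq_succ_of_ne_zero h0
    have hlt : m < N := by omega
    refine det_zero_of_row_eq (i := 0) (j := (⟨m, hlt⟩ : Fin N).succ) (Fin.succ_ne_zero _).symm ?_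
    ext j
    simp [-Fin.succ_mk]

/-- Coefficients of a product of linear factors. -/
theorem exists_prod_one_sub_mul_eq_sum {R : Type*} [CommRing R] {N : ℕ} (y : Fin N → R) :
    ∃ a : ℕ → R, a 0 = 1 ∧ a N = (-1) ^ N * ∏ k, y k ∧
      ∀ s, ∏ k, (1 - s * y k) = ∑ m ∈ range (N + 1), a m * s ^ m := by
  induction N with
  | zero => exact ⟨fun _ => 1, by simp⟩
  | succ N ih =>
    obtain ⟨a, h0, hN, ha⟩ := ih (y ∘ Fin.succ)
    refine ⟨fun m => (if m ≤ N then a m else 0) - (if m = 0 then 0 else y 0 * a (m - 1)),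
      by simp [h0], ?_, fun s => ?_⟩
    · simp [hN, Fin.prod_univ_succ]; ring
    · have := ha s
      simp only [Function.comp_apply] at this
      rw [Fin.prod_univ_succ, this]
      simp only [sub_mul, sum_sub_distrib, one_mul]
      congr 1
      · rw [sum_range_succ _ (N + 1)]
        simp only [Nat.not_succ_le_self, if_false, zero_mul, add_zero]
        refine sum_congr rfl fun m hm => ?_
        rw [if_pos (by simpa [Nat.lt_succ_iff] using hm)]
      · rw [sum_range_succ' _ (N + 1), mul_sum]
        simp only [if_true, zero_mul, add_zero]
        refine sum_congr rfl fun m _ => ?_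
        simp [pow_succ]; ring

theorem sum_prod_one_sub_mul_vandermonde {R : Type*} [CommRing R] {N : ℕ} (x : Fin (N + 1) → R)
    (c : R) :
    ∑ j : Fin (N + 1), (-1) ^ (j : ℕ) * (∏ k, (1 - x j * (c * x k))) *
        ((∏ k, x (j.succAbove k)) * alternant 0 (x ∘ j.succAbove)) =
      (1 - c ^ (N + 1) * (∏ k, x k) ^ 2) * alternant 0 x := by
  obtain ⟨a, h0, hN, ha⟩ := exists_prod_one_sub_mul_eq_sum fun k => c * x k
  have key : ∀ m ∈ range (N + 1 + 1), _ := fun m hm =>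
    congrArg (a m * ·) (sum_pow_mul_vandermonde x (m := m) (by simpa [Nat.lt_succ_iff] using hm))
  have hsum := sum_congr rfl key
  simp only [mul_sum] at hsum
  rw [sum_comm] at hsum
  calc _ = _ := by
        refine (sum_congr rfl fun j _ => ?_).trans hsum
        rw [ha, mul_sum, sum_mul]
        exact sum_congr rfl fun m _ => by ring
    _ = _ := by
        rw [sum_range_succ', sum_range_succ]
        rw [sum_eq_zero fun m hm => by
          rw [if_neg (by simp), if_neg (by simp at hm ⊢; omega), mul_zero]]
        simp only [Nat.add_eq_zero_iff, one_ne_zero, and_false, if_false, if_true, h0, hN,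
          prod_mul_distrib, prod_const, card_univ, Fintype.card_fin]
        have : ((-1 : R) ^ N) ^ 2 = 1 := by rw [← pow_mul, mul_comm, pow_mul]; simp
        linear_combination (- c ^ (N + 1) * (∏ k, x k) ^ 2 * alternant 0 x) * this

/-- Splitting off an index from a product over unordered pairs. -/
theorem prod_pairs_succAbove {M : Type*} [CommMonoid M] {N : ℕ} (g : Fin (N + 1) → Fin (N + 1) → M)
    (hg : ∀ i k, g i k = g k i) (j : Fin (N + 1)) :
    ∏ q : Fin (N + 1) × Fin (N + 1) with q.1 ≤ q.2, g q.1 q.2 =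
      (∏ k, g j k) *
        ∏ q : Fin N × Fin N with q.1 ≤ q.2, g (j.succAbove q.1) (j.succAbove q.2) := by
  simp only [prod_filter, Fintype.prod_prod_type]
  rw [Fin.prod_univ_succAbove _ j, Fin.prod_univ_succAbove (fun k => g j k) j,
    Fin.prod_univ_succAbove _ j]
  simp only [fun i => Fin.prod_univ_succAbove (fun k => if j.succAbove i ≤ k then
    g (j.succAbove i) k else 1) j, prod_mul_distrib, le_refl, if_true,
    (Fin.strictMono_succAbove j).le_iff_le, mul_assoc]
  congr 1
  rw [← mul_assoc, ← prod_mul_distrib]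
  congr 1
  refine prod_congr rfl fun k _ => ?_
  have := Fin.succAbove_ne j k
  rcases lt_or_gt_of_ne this with h | h
  · rw [if_neg h.not_ge, if_pos h.le, one_mul, hg]
  · rw [if_pos h.le, if_neg h.not_ge, mul_one]

open Classical in
/-- The weakly increasing sequences of `N` even natural numbers with sum `n`. -/
noncomputable def evenMonotone (N n : ℕ) : Finset (Fin N → ℕ) :=
  {f ∈ Fintype.piFinset fun _ => range (n + 1) | Monotone f ∧ (∀ i, Even (f i)) ∧ ∑ i, f i = n}

theorem mem_evenMonotone {N n : ℕ} {f : Fin N → ℕ} :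
    f ∈ evenMonotone N n ↔ Monotone f ∧ (∀ i, Even (f i)) ∧ ∑ i, f i = n := by
  simp only [evenMonotone, mem_filter, Fintype.mem_piFinset, mem_range, and_iff_right_iff_imp]
  rintro ⟨-, -, h⟩ i
  rw [Nat.lt_succ_iff, ← h]
  exact single_le_sum (f := f) (fun _ _ => Nat.zero_le _) (mem_univ i)

theorem sum_evenMonotone_head_eq_zero {M : Type*} [AddCommMonoid M] {N n : ℕ}
    (F : (Fin (N + 1) → ℕ) → M) :
    ∑ f ∈ evenMonotone (N + 1) n with f 0 = 0, F f =
      ∑ f ∈ evenMonotone N n, F (Fin.cons 0 f : Fin (N + 1) → ℕ) := by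
  symm
  refine sum_bij (fun f _ => (Fin.cons 0 f : Fin (N + 1) → ℕ)) ?_ ?_ ?_ fun _ _ => rfl
  · intro f hf
    obtain ⟨hm, he, hs⟩ := mem_evenMonotone.1 hf
    refine mem_filter.2 ⟨mem_evenMonotone.2 ⟨?_, ?_, ?_⟩, rfl⟩
    · intro i j
      refine Fin.cases (by simp) (fun i => ?_) i
      refine Fin.cases (by simp) (fun j => ?_) j
      intro h
      simpa using hm (Fin.succ_le_succ_iff.1 h)
    · exact Fin.cases (by simp) (by simpa using he)
    · simpa [Fin.sum_univ_succ] using hs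
  · intro f _ g _ h
    exact (Fin.cons_injective2 h).2
  · intro f hf
    obtain ⟨hf, h0⟩ := mem_filter.1 hf
    obtain ⟨hm, he, hs⟩ := mem_evenMonotone.1 hf
    refine ⟨Fin.tail f, mem_evenMonotone.2 ⟨?_, fun i => he _, ?_⟩, ?_⟩
    · exact fun i j h => hm (Fin.succ_le_succ_iff.2 h)
    · simpa [Fin.sum_univ_succ, h0, Fin.tail] using hs
    · rw [← h0, Fin.cons_self_tail]

theorem sum_evenMonotone_head_ne_zero {M : Type*} [AddCommMonoid M] {N n : ℕ}
    (F : (Fin (N + 1) → ℕ) → M) :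
    ∑ f ∈ evenMonotone (N + 1) n with ¬ f 0 = 0, F f =
      if 2 * (N + 1) ≤ n then
        ∑ f ∈ evenMonotone (N + 1) (n - 2 * (N + 1)), F (fun i => f i + 2) else 0 := by
  have two_le : ∀ f ∈ evenMonotone (N + 1) n, ¬ f 0 = 0 → ∀ i, 2 ≤ f i := by
    intro f hf h0 i
    obtain ⟨hm, he, -⟩ := mem_evenMonotone.1 hf
    have := hm (Fin.zero_le i)
    obtain ⟨k, hk⟩ := he 0
    omega
  split_ifs with hn
  · symm
    refine sum_bij (fun f _ i => f i + 2) ?_ ?_ ?_ fun _ _ => rfl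
    · intro f hf
      obtain ⟨hm, he, hs⟩ := mem_evenMonotone.1 hf
      refine mem_filter.2 ⟨mem_evenMonotone.2 ⟨?_, ?_, ?_⟩, by simp⟩
      · exact fun i j h => Nat.add_le_add_right (hm h) 2
      · exact fun i => (he i).add even_two
      · simp [sum_add_distrib, hs]; omega
    · intro f _ g _ h
      ext i
      simpa using congrFun h i
    · intro f hf
      obtain ⟨hf, h0⟩ := mem_filter.1 hf
      have h2 := two_le f hf h0
      obtain ⟨hm, he, hs⟩ := mem_evenMonotone.1 hf
      have hf' : (fun i => f i - 2 + 2) = f := funext fun i => Nat.sub_add_cancel (h2 i)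
      refine ⟨fun i => f i - 2, mem_evenMonotone.2 ⟨?_, ?_, ?_⟩, hf'⟩
      · exact fun i j h => Nat.sub_le_sub_right (hm h) 2
      · exact fun i => (Nat.even_sub (h2 i)).2 (by simp [he i])
      · rw [← hf'] at hs
        simp [sum_add_distrib] at hs ⊢
        omega
  · refine sum_eq_zero fun f hf => (hn ?_).elim
    obtain ⟨hf, h0⟩ := mem_filter.1 hf
    have h2 := two_le f hf h0
    rw [← (mem_evenMonotone.1 hf).2.2]
    calc 2 * (N + 1) = ∑ i : Fin (N + 1), 2 := by simp [mul_comm]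
      _ ≤ _ := sum_le_sum fun i _ => h2 i

/-- The generating function of the alternants indexed by even partitions of length at most `N`. -/
noncomputable def evenAlternantSeries {R : Type*} [CommRing R] {N : ℕ} (x : Fin N → R) :
    PowerSeries R :=
  PowerSeries.mk fun n => ∑ f ∈ evenMonotone N n, alternant f x

theorem evenAlternantSeries_succ {R : Type*} [CommRing R] {N : ℕ} (x : Fin (N + 1) → R) :
    (1 - (PowerSeries.X ^ 2) ^ (N + 1) * PowerSeries.C ((∏ k, x k) ^ 2)) *
        evenAlternantSeries x =
      ∑ j : Fin (N + 1), PowerSeries.C ((-1) ^ (j : ℕ) * ∏ k, x (j.succAbove k)) *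
        evenAlternantSeries (x ∘ j.succAbove) := by
  ext n
  rw [sub_mul, one_mul, ← pow_mul, mul_assoc, map_sub, PowerSeries.coeff_X_pow_mul', map_sum]
  simp only [PowerSeries.coeff_C_mul, evenAlternantSeries, PowerSeries.coeff_mk]
  rw [← sum_filter_add_sum_filter_not _ (fun f => f 0 = 0), sum_evenMonotone_head_eq_zero,
    sum_evenMonotone_head_ne_zero]
  simp only [alternant_add_const, alternant_cons_zero, ← mul_sum, add_sub_cancel_right]
  rw [sum_comm]
  refine sum_congr rfl fun j _ => ?_
  simp only [mul_sum, mul_assoc]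

theorem prod_mul_evenAlternantSeries {R : Type*} [CommRing R] {N : ℕ} (x : Fin N → R) :
    (∏ q : Fin N × Fin N with q.1 ≤ q.2,
        (1 - PowerSeries.C (x q.1) * (PowerSeries.X ^ 2 * PowerSeries.C (x q.2)))) *
      evenAlternantSeries x = PowerSeries.C (alternant 0 x) := by
  induction N with
  | zero =>
    ext n
    rw [filter_eq_empty_iff.2 (by simp)]
    simp only [prod_empty, one_mul, evenAlternantSeries, PowerSeries.coeff_mk,
      PowerSeries.coeff_C]
    split_ifs with h
    · subst h
      rw [show evenMonotone 0 0 = {0} by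
        ext f; simp [mem_evenMonotone, Subsingleton.elim f 0, Subsingleton.monotone]]
      simp
    · rw [show evenMonotone 0 n = ∅ by
        ext f; simp [mem_evenMonotone, Ne.symm h]]
      simp
  | succ N ih =>
    have hu : IsUnit (1 - (PowerSeries.X ^ 2) ^ (N + 1) * PowerSeries.C ((∏ k, x k) ^ 2) :
        PowerSeries R) := by
      rw [PowerSeries.isUnit_iff_constantCoeff]
      simp
    refine hu.mul_left_cancel ?_
    rw [mul_left_comm, evenAlternantSeries_succ, mul_sum]
    have h := sum_prod_one_sub_mul_vandermonde (fun k => PowerSeries.C (x k))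
      (PowerSeries.X ^ 2)
    have hC : ∀ {M : ℕ} (y : Fin M → R),
        alternant 0 (fun k => PowerSeries.C (y k)) = PowerSeries.C (alternant 0 y) := by
      intro M y
      simp only [alternant]
      rw [RingHom.map_det]
      congr 1
      ext1 i j
      simp
    simp only [hC, Function.comp_def, ← map_prod, ← map_pow] at h
    rw [← h]
    refine sum_congr rfl fun j _ => ?_
    rw [prod_pairs_succAbove (fun i k => 1 - PowerSeries.C (x i) * (PowerSeries.X ^ 2 *
      PowerSeries.C (x k))) (fun i k => by ring) j]
    have := ih (x ∘ j.succAbove)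
    simp only [Function.comp_apply] at this
    rw [mul_assoc, mul_left_comm (∏ q with _, _), this]
    simp only [map_mul, map_pow, map_neg, map_one, Function.comp_def]
    ring

/-- The generating function of the complete homogeneous symmetric functions of `x`. -/
noncomputable def hSeries {R : Type*} [CommRing R] {N : ℕ} (x : Fin N → R) : PowerSeries R :=
  ∏ l, PowerSeries.mk fun n => x l ^ n

/-- The complete homogeneous symmetric function of `x` of integer degree. -/
noncomputable def hCoeff {R : Type*} [CommRing R] {N : ℕ} (x : Fin N → R) (d : ℤ) : R :=
  if 0 ≤ d then PowerSeries.coeff d.toNat (hSeries x) else 0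

theorem mk_pow_mul_one_sub {R : Type*} [CommRing R] (a : R) :
    (PowerSeries.mk fun n => a ^ n) * (1 - PowerSeries.C a * PowerSeries.X) = 1 := by
  ext n
  rw [mul_sub, mul_one, mul_left_comm, map_sub, PowerSeries.coeff_C_mul]
  cases n with
  | zero => simp
  | succ n => simp [PowerSeries.coeff_one, pow_succ, mul_comm]

theorem hSeries_mul_prod_erase {R : Type*} [CommRing R] {N : ℕ} (x : Fin N → R) (k : Fin N) :
    (∏ l ∈ univ.erase k, (1 - PowerSeries.C (x l) * PowerSeries.X)) * hSeries x =
      PowerSeries.mk fun n => x k ^ n := by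
  rw [hSeries, ← mul_prod_erase univ _ (mem_univ k), mul_left_comm, ← prod_mul_distrib]
  rw [prod_congr rfl fun l _ => (mul_comm _ _).trans (mk_pow_mul_one_sub (x l)), prod_const_one,
    mul_one]

theorem coeff_prod_one_sub_C_mul_X {R ι : Type*} [CommRing R] (x : ι → R) (s : Finset ι) {n : ℕ}
    (hn : s.card < n) :
    PowerSeries.coeff n (∏ l ∈ s, (1 - PowerSeries.C (x l) * PowerSeries.X)) = 0 := by
  classical
  induction s using Finset.induction_on generalizing n with
  | empty => simp [PowerSeries.coeff_one, (Nat.zero_lt_of_lt hn).ne']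
  | insert a s ha ih =>
    rw [card_insert_of_notMem ha] at hn
    obtain ⟨n, rfl⟩ := Nat.exists_eq_succ_of_ne_zero (Nat.zero_lt_of_lt hn).ne'
    rw [prod_insert ha, sub_mul, one_mul, mul_assoc, map_sub, PowerSeries.coeff_C_mul,
      PowerSeries.coeff_succ_X_mul, ih (by omega), ih (by omega)]
    simp

theorem sum_hCoeff_mul {R : Type*} [CommRing R] {N : ℕ} (x : Fin N → R) (k : Fin N) (a : ℕ) :
    ∑ j : Fin N, hCoeff x ((a : ℤ) - (j : ℤ)) *
        PowerSeries.coeff (j : ℕ)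
          (∏ l ∈ univ.erase k, (1 - PowerSeries.C (x l) * PowerSeries.X)) = x k ^ a := by
  set P := ∏ l ∈ univ.erase k, (1 - PowerSeries.C (x l) * PowerSeries.X)
  have h := congrArg (PowerSeries.coeff a) (hSeries_mul_prod_erase x k)
  rw [PowerSeries.coeff_mk, PowerSeries.coeff_mul,
    Nat.sum_antidiagonal_eq_sum_range_succ_mk] at h
  have h' : ∑ j ∈ range (a + 1), hCoeff x ((a : ℤ) - (j : ℤ)) * PowerSeries.coeff j P =
      x k ^ a := by
    rw [← h]
    refine sum_congr rfl fun j hj => ?_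
    simp only [mem_range] at hj
    rw [hCoeff, if_pos (by omega), show ((a : ℤ) - j).toNat = a - j by omega, mul_comm]
  rw [← h', Fin.sum_univ_eq_sum_range
      (fun j => hCoeff x ((a : ℤ) - (j : ℤ)) * PowerSeries.coeff j P) N,
    sum_subset (range_subset_range.2 (Nat.le_add_right N (a + 1))),
    sum_subset (range_subset_range.2 (Nat.le_add_left (a + 1) N))]
  · intro j _ hj
    rw [mem_range] at hj
    rw [hCoeff, if_neg (by omega), zero_mul]
  · intro j _ hj
    rw [mem_range] at hj
    rw [coeff_prod_one_sub_C_mul_X, mul_zero]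
    rw [card_erase_of_mem (mem_univ k), card_univ, Fintype.card_fin]
    have := k.pos
    omega

/-- The bialternant formula for Jacobi–Trudi determinants. -/
theorem det_hCoeff_mul_alternant {R : Type*} [CommRing R] {N : ℕ} (f : Fin N → ℕ)
    (x : Fin N → R) :
    Matrix.det (Matrix.of fun i j : Fin N => hCoeff x ((f i : ℤ) + i - j)) * alternant 0 x =
      alternant f x := by
  set M : Matrix (Fin N) (Fin N) R := Matrix.of fun j k => PowerSeries.coeff (j : ℕ)
    (∏ l ∈ univ.erase k, (1 - PowerSeries.C (x l) * PowerSeries.X)) with hM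
  have key : ∀ g : Fin N → ℕ,
      Matrix.det (Matrix.of fun i j : Fin N => hCoeff x ((g i : ℤ) + i - j)) * M.det =
        alternant g x := by
    intro g
    rw [← det_mul, alternant]
    congr 1
    ext i k
    rw [mul_apply, of_apply, ← sum_hCoeff_mul x k (g i + i)]
    simp [hM]
  have h0 := key 0
  rw [det_of_isLowerTriangular] at h0
  · rw [← h0, ← key f]
    simp [hCoeff, hSeries, map_prod]
  · intro i j hij
    have : (i : ℕ) < j := hij
    simp [hCoeff]
    omega

theorem prod_map_eq_prod_pow_count {R σ : Type*} [CommRing R] [Fintype σ] [DecidableEq σ] (x : σ → R)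
    (s : Multiset σ) : (s.map x).prod = ∏ i, x i ^ s.count i := by
  rw [prod_multiset_map_count]
  refine prod_subset (subset_univ _) fun i _ hi => ?_
  rw [Multiset.count_eq_zero_of_notMem (by simpa using hi), pow_zero]

theorem coeff_hSeries_X (N n : ℕ) :
    PowerSeries.coeff n (hSeries fun i : Fin N => (MvPolynomial.X i : MvPolynomial (Fin N) ℂ)) =
      hsymm (Fin N) ℂ n := by
  rw [hSeries, PowerSeries.coeff_prod, hsymm]
  simp only [PowerSeries.coeff_mk]
  symm
  refine sum_bij (fun s _ => Multiset.toFinsupp s.1) ?_ ?_ ?_ ?_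
  · intro s _
    rw [mem_finsuppAntidiag]
    refine ⟨?_, subset_univ _⟩
    change ∑ i, s.1.count i = n
    rw [Multiset.sum_count_eq_card fun _ _ => mem_univ _]
    exact s.2
  · intro s _ t _ h
    exact Subtype.ext (Multiset.toFinsupp.injective h)
  · intro f hf
    rw [mem_finsuppAntidiag] at hf
    refine ⟨⟨Finsupp.toMultiset f, ?_⟩, mem_univ _, by simp⟩
    rw [Finsupp.card_toMultiset, ← hf.1]
    exact Finsupp.sum_fintype _ _ fun _ => rfl
  · intro s _
    simp [prod_map_eq_prod_pow_count]

theorem hpolyZ_eq_hCoeff (N : ℕ) (d : ℤ) :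
    hpolyZ (Fin N) d = hCoeff (fun i : Fin N => (MvPolynomial.X i : MvPolynomial (Fin N) ℂ)) d := by
  simp only [hpolyZ, hCoeff, coeff_hSeries_X]

theorem hsymm_isHomogeneous (σ : Type*) [Fintype σ] [DecidableEq σ] (n : ℕ) :
    (hsymm σ ℂ n).IsHomogeneous n := by
  refine IsHomogeneous.sum _ _ _ fun s _ => ?_
  have h : ∀ m : Multiset σ, (m.map (X (R := ℂ))).prod.IsHomogeneous m.card := by
    intro m
    induction m using Multiset.induction_on with
    | empty => simpa using isHomogeneous_one σ ℂ
    | cons a m ih =>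
      rw [Multiset.map_cons, Multiset.prod_cons, Multiset.card_cons, add_comm]
      exact (isHomogeneous_X ℂ a).mul ih
  have hs := h s.1
  rw [s.2] at hs
  exact hs

theorem schurPoly_isHomogeneous (σ : Type*) [Fintype σ] [DecidableEq σ] (l : List ℕ) :
    (schurPoly σ l).IsHomogeneous l.sum := by
  rw [schurPoly, det_apply]
  refine IsHomogeneous.sum _ _ _ fun τ _ => ?_
  rw [Units.smul_def, zsmul_eq_mul, ← map_intCast (C : ℂ →+* MvPolynomial σ ℂ)]
  rw [← zero_add l.sum]
  refine (isHomogeneous_C _ _).mul ?_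
  by_cases h : ∀ i, 0 ≤ (l.get (τ i) : ℤ) - (τ i : ℕ) + (i : ℕ)
  · have hs : l.sum = ∑ i, ((l.get (τ i) : ℤ) - (τ i : ℕ) + (i : ℕ)).toNat := by
      apply Nat.cast_injective (R := ℤ)
      rw [Nat.cast_sum, sum_congr rfl fun i _ => Int.toNat_of_nonneg (h i), sum_add_distrib,
        sum_sub_distrib, Equiv.sum_comp τ (fun i => (l.get i : ℤ)),
        Equiv.sum_comp τ (fun i => ((i : ℕ) : ℤ)), sub_add_cancel]
      exact_mod_cast (Fin.sum_univ_getElem l).symm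
    rw [hs]
    refine IsHomogeneous.prod _ _ _ fun i _ => ?_
    rw [of_apply, hpolyZ, if_pos (h i)]
    exact hsymm_isHomogeneous _ _
  · push Not at h
    obtain ⟨i, hi⟩ := h
    rw [prod_eq_zero (mem_univ i)]
    · exact isHomogeneous_zero _ _ _
    · rw [of_apply, hpolyZ, if_neg hi.not_ge]

theorem schurPoly_eq_det (σ : Type*) [Fintype σ] [DecidableEq σ] {l : List ℕ} {n : ℕ}
    (hl : l.length = n) :
    schurPoly σ l = Matrix.det (Matrix.of fun i j : Fin n =>
      hpolyZ σ ((l.get (Fin.cast hl.symm i) : ℤ) - (i : ℤ) + (j : ℤ))) := by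
  subst hl
  rfl

theorem schurPoly_append_zero (σ : Type*) [Fintype σ] [DecidableEq σ] (l : List ℕ) :
    schurPoly σ (l ++ [0]) = schurPoly σ l := by
  rw [schurPoly_eq_det σ (List.length_append : _ = l.length + 1), det_succ_row _ (Fin.last _),
    sum_eq_single (Fin.last _)]
  · simp [schurPoly, hpolyZ, ← two_mul, submatrix]
  · intro j _ hj
    have : (j : ℕ) < l.length := Fin.val_lt_last hj
    simp [hpolyZ, this]
  · simp

theorem schurPoly_append_replicate_zero (σ : Type*) [Fintype σ] [DecidableEq σ] (l : List ℕ)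
    (k : ℕ) : schurPoly σ (l ++ List.replicate k 0) = schurPoly σ l := by
  induction k with
  | zero => simp
  | succ k ih => rw [List.replicate_succ', ← List.append_assoc, schurPoly_append_zero, ih]

theorem schurPoly_ofFn_rev_mul_alternant {N : ℕ} (f : Fin N → ℕ) :
    schurPoly (Fin N) (List.ofFn (f ∘ Fin.rev)) * alternant 0 X = alternant f X := by
  rw [← det_hCoeff_mul_alternant f, schurPoly_eq_det _ List.length_ofFn,
    ← det_submatrix_equiv_self Fin.revPerm]
  congr 2
  ext1 i j
  simp only [submatrix_apply, of_apply, hpolyZ_eq_hCoeff]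
  have hget : (List.ofFn (f ∘ Fin.rev)).get (Fin.cast List.length_ofFn.symm i.rev) = f i := by
    rw [List.get_ofFn]
    exact congrArg f i.rev_rev
  simp only [Fin.revPerm_apply, hget, Fin.val_rev]
  congr 1
  omega

theorem coe_partsList {n : ℕ} (p : Nat.Partition n) : (partsList p : Multiset ℕ) = p.parts :=
  Multiset.sort_eq _ _

theorem sortedGE_partsList_append {n : ℕ} (p : Nat.Partition n) (k : ℕ) :
    (partsList p ++ List.replicate k 0).SortedGE := by
  refine List.Pairwise.sortedGE (List.pairwise_append.2 ⟨Multiset.pairwise_sort _ _, ?_, ?_⟩)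
  · simp [List.pairwise_replicate]
  · intro a _ b hb
    simp [List.eq_of_mem_replicate hb]

theorem coe_ofFn_comp_rev {α : Type*} {N : ℕ} (f : Fin N → α) :
    (List.ofFn (f ∘ Fin.rev) : Multiset α) = univ.val.map f := by
  rw [Fin.univ_val_map, Multiset.coe_eq_coe]
  exact Equiv.Perm.ofFn_comp_perm Fin.revPerm f

theorem ofFn_rev_eq_partsList_append {N n : ℕ} {f : Fin N → ℕ} (hf : Monotone f)
    (hs : (univ.val.map f).sum = n) :
    ∃ k, List.ofFn (f ∘ Fin.rev) =
      partsList (Nat.Partition.ofSums n (univ.val.map f) hs) ++ List.replicate k 0 := by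
  refine ⟨(univ.val.map f).count 0, List.Perm.eq_of_sortedGE ?_ ?_ ?_⟩
  · rw [List.sortedGE_ofFn_iff]
    exact fun i j hij => hf (Fin.rev_le_rev.2 hij)
  · exact sortedGE_partsList_append _ _
  · rw [← Multiset.coe_eq_coe, ← Multiset.coe_add, coe_ofFn_comp_rev, coe_partsList,
      Multiset.coe_replicate, ← Multiset.filter_eq', add_comm]
    exact (Multiset.filter_add_not _ _).symm

theorem sum_evenMonotone_eq_sum_partition {M : Type*} [AddCommMonoid M] (N n : ℕ)
    (F : List ℕ → M) (hF : ∀ l k, F (l ++ List.replicate k 0) = F l) :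
    ∑ f ∈ evenMonotone N n, F (List.ofFn (f ∘ Fin.rev)) =
      ∑ p : Nat.Partition n with p.parts.card ≤ N ∧ ∀ a ∈ p.parts, Even a, F (partsList p) := by
  refine sum_bij
    (fun f hf => Nat.Partition.ofSums n (univ.val.map f) (mem_evenMonotone.1 hf).2.2) ?_ ?_ ?_ ?_
  · intro f hf
    obtain ⟨-, he, -⟩ := mem_evenMonotone.1 hf
    simp only [mem_filter, Nat.Partition.ofSums]
    refine ⟨mem_univ _, ?_, ?_⟩
    · refine (Multiset.card_le_card (Multiset.filter_le _ _)).trans ?_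
      simp
    · intro a ha
      obtain ⟨i, -, rfl⟩ := Multiset.mem_map.1 (Multiset.mem_filter.1 ha).1
      exact he i
  · intro f hf g hg h
    obtain ⟨k, hk⟩ := ofFn_rev_eq_partsList_append (mem_evenMonotone.1 hf).1
      (mem_evenMonotone.1 hf).2.2
    obtain ⟨m, hm⟩ := ofFn_rev_eq_partsList_append (mem_evenMonotone.1 hg).1
      (mem_evenMonotone.1 hg).2.2
    rw [← h] at hm
    have hkm : k = m := by
      have h1 := congrArg List.length hk
      have h2 := congrArg List.length hm
      simp only [List.length_ofFn, List.length_append, List.length_replicate] at h1 h2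
      omega
    rw [← hkm, ← hk] at hm
    exact (Fin.rev_surjective.injective_comp_right (List.ofFn_injective hm)).symm
  · intro p hp
    obtain ⟨-, hc, he⟩ := mem_filter.1 hp
    set l := partsList p ++ List.replicate (N - p.parts.card) 0 with hl
    have hlen : l.length = N := by
      simp [hl, partsList, hc]
    have hsort : l.SortedGE := sortedGE_partsList_append _ _
    set f : Fin N → ℕ := fun i => l.get (Fin.cast hlen.symm i.rev) with hf
    have hfl : List.ofFn (f ∘ Fin.rev) = l := by
      refine List.ext_get (by simp [hlen]) fun i _ _ => ?_
      rw [List.get_ofFn]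
      simp only [Function.comp_apply, hf, Fin.rev_rev]
      rfl
    have hmap : univ.val.map f = p.parts + Multiset.replicate (N - p.parts.card) 0 := by
      rw [← coe_ofFn_comp_rev, hfl, hl, ← Multiset.coe_add, coe_partsList, Multiset.coe_replicate]
    refine ⟨f, mem_evenMonotone.2 ⟨?_, ?_, ?_⟩, ?_⟩
    · exact fun i j hij => hsort.antitone_get (Fin.rev_le_rev.2 hij)
    · intro i
      have : f i ∈ univ.val.map f := Multiset.mem_map_of_mem f (mem_univ i)
      rw [hmap, Multiset.mem_add] at this
      rcases this with h | h
      · exact he _ h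
      · simp [Multiset.eq_of_mem_replicate h]
    · have h := congrArg Multiset.sum hmap
      rw [Multiset.sum_add, p.parts_sum, Multiset.sum_replicate, smul_zero, add_zero] at h
      exact h
    · ext1
      simp only [Nat.Partition.ofSums, hmap, Multiset.filter_add]
      rw [Multiset.filter_eq_self.2 fun a ha => (p.parts_pos ha).ne',
        Multiset.filter_eq_nil.2 fun a ha => by simp [Multiset.eq_of_mem_replicate ha], add_zero]
  · intro f hf
    obtain ⟨k, hk⟩ := ofFn_rev_eq_partsList_append (mem_evenMonotone.1 hf).1
      (mem_evenMonotone.1 hf).2.2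
    rw [hk, hF]

theorem prod_mul_mk_schurPoly (N : ℕ) :
    (∏ q : Fin N × Fin N with q.1 ≤ q.2,
        (1 - PowerSeries.C (X q.1) * (PowerSeries.X ^ 2 * PowerSeries.C (X q.2)))) *
      PowerSeries.mk (fun n => ∑ p : Nat.Partition n with
        p.parts.card ≤ N ∧ ∀ a ∈ p.parts, Even a, schurPoly (Fin N) (partsList p)) = 1 := by
  have hV : (PowerSeries.C (alternant 0 X : MvPolynomial (Fin N) ℂ)) ≠ 0 := by
    rw [Ne, map_eq_zero_iff _ PowerSeries.C_injective, alternant_zero]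
    exact det_vandermonde_ne_zero_iff.2 (X_injective)
  refine mul_right_cancel₀ hV ?_
  rw [mul_assoc, one_mul]
  conv_rhs => rw [← prod_mul_evenAlternantSeries]
  congr 1
  ext1 n
  rw [PowerSeries.coeff_mul_C, evenAlternantSeries, PowerSeries.coeff_mk, PowerSeries.coeff_mk,
    ← sum_evenMonotone_eq_sum_partition N n _ (schurPoly_append_replicate_zero _), sum_mul]
  exact sum_congr rfl fun f _ => schurPoly_ofFn_rev_mul_alternant f

/-- `g` is the grading by total degree of the power series `f`: its `n`-th coefficient is the
homogeneous component of degree `n` of `f`. -/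
def IsGradingOf {σ R : Type*} [CommRing R] (f : MvPowerSeries σ R)
    (g : PowerSeries (MvPolynomial σ R)) : Prop :=
  ∀ n d, MvPolynomial.coeff d (PowerSeries.coeff n g) =
    if d.degree = n then MvPowerSeries.coeff d f else 0

namespace IsGradingOf

variable {σ R : Type*} [CommRing R] {f f' : MvPowerSeries σ R}
  {g g' : PowerSeries (MvPolynomial σ R)}

theorem congr_left (h : IsGradingOf f g) (h' : IsGradingOf f' g) : f = f' := by
  ext d
  have h1 := h d.degree d
  rw [h' d.degree d, if_pos rfl, if_pos rfl] at h1
  exact h1.symm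

theorem one : IsGradingOf (1 : MvPowerSeries σ R) 1 := by
  classical
  intro n d
  rw [PowerSeries.coeff_one, MvPowerSeries.coeff_one]
  by_cases hd : d = 0
  · subst hd
    by_cases hn : n = 0 <;> simp [hn, eq_comm]
  · split_ifs <;> simp [MvPolynomial.coeff_one, Ne.symm hd]

theorem X (i : σ) : IsGradingOf (MvPowerSeries.X i : MvPowerSeries σ R)
    (PowerSeries.C (MvPolynomial.X i) * PowerSeries.X) := by
  classical
  intro n d
  rw [PowerSeries.coeff_C_mul, PowerSeries.coeff_X, MvPowerSeries.coeff_X]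
  by_cases hd : d = Finsupp.single i 1
  · subst hd
    by_cases hn : n = 1 <;> simp [hn, eq_comm]
  · split_ifs <;> simp [MvPolynomial.coeff_X, Ne.symm hd]

theorem sub (h : IsGradingOf f g) (h' : IsGradingOf f' g') : IsGradingOf (f - f') (g - g') := by
  intro n d
  rw [map_sub, MvPolynomial.coeff_sub, h, h', map_sub]
  split_ifs <;> simp

theorem mul (h : IsGradingOf f g) (h' : IsGradingOf f' g') : IsGradingOf (f * f') (g * g') := by
  classical
  intro n d
  rw [PowerSeries.coeff_mul, MvPolynomial.coeff_sum, MvPowerSeries.coeff_mul]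
  simp only [MvPolynomial.coeff_mul, h _ _, h' _ _]
  rw [sum_comm]
  split_ifs with hd
  · refine sum_congr rfl fun u hu => ?_
    rw [HasAntidiagonal.mem_antidiagonal] at hu
    rw [sum_eq_single (u.1.degree, u.2.degree)]
    · simp
    · intro a _ ha
      rw [Ne, Prod.ext_iff] at ha
      by_cases h1 : u.1.degree = a.1
      · rw [if_neg (c := u.2.degree = a.2) fun h2 => ha ⟨h1.symm, h2.symm⟩, mul_zero]
      · rw [if_neg h1, zero_mul]
    · intro ha
      rw [HasAntidiagonal.mem_antidiagonal] at ha
      exact (ha (by rw [← hd, ← hu, map_add])).elim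
  · refine sum_eq_zero fun u hu => sum_eq_zero fun a ha => ?_
    rw [HasAntidiagonal.mem_antidiagonal] at hu ha
    by_cases h1 : u.1.degree = a.1
    · rw [if_neg (c := u.2.degree = a.2), mul_zero]
      intro h2
      exact hd (by rw [← hu, ← ha, map_add, h1, h2])
    · rw [if_neg h1, zero_mul]

theorem prod {ι : Type*} (s : Finset ι) {F : ι → MvPowerSeries σ R}
    {G : ι → PowerSeries (MvPolynomial σ R)} (h : ∀ i ∈ s, IsGradingOf (F i) (G i)) :
    IsGradingOf (∏ i ∈ s, F i) (∏ i ∈ s, G i) := by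
  classical
  induction s using Finset.induction_on with
  | empty => simpa using one
  | insert a s ha ih =>
    rw [prod_insert ha, prod_insert ha]
    exact (h a (mem_insert_self a s)).mul (ih fun i hi => h i (mem_insert_of_mem hi))

end IsGradingOf

theorem isGradingOf_sum_schurPoly (N : ℕ) :
    IsGradingOf (fun d : Fin N →₀ ℕ => MvPolynomial.coeff d
        (∑ p : Nat.Partition (d.sum fun _ e => e) with
          p.parts.card ≤ N ∧ ∀ a ∈ p.parts, Even a, schurPoly (Fin N) (partsList p)))
      (PowerSeries.mk fun n => ∑ p : Nat.Partition n with
        p.parts.card ≤ N ∧ ∀ a ∈ p.parts, Even a, schurPoly (Fin N) (partsList p)) := by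
  intro n d
  rw [PowerSeries.coeff_mk]
  split_ifs with h
  · subst h
    rfl
  · refine IsHomogeneous.coeff_eq_zero (IsHomogeneous.sum _ _ n fun p _ => ?_) h
    have hp : (partsList p).sum = n := by
      rw [← Multiset.sum_coe, coe_partsList, p.parts_sum]
    have hs := schurPoly_isHomogeneous (Fin N) (partsList p)
    rwa [hp] at hs

end

/-- Littlewood's identity `∏_{i ≤ j} (1 - x_i x_j)^{-1} = ∑_{λ even} s_λ(x)`
(sum over partitions with all parts even, of length `≤ N`), as formal power series in
`x_1,…,x_N`: the right-hand side (defined coefficientwise; `s_λ` is homogeneous of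
degree `|λ|`) times `∏_{i ≤ j} (1 - x_i x_j)` equals `1`.  This is the symmetric-function
form of the multiplicity-free `GL_N`-decomposition `S(S²(ℂ^N)) = ⊕_{λ even} L_λ`. -/
theorem littlewood_identity (N : ℕ)
    (S : MvPowerSeries (Fin N) ℂ)
    (hS : S = fun d : Fin N →₀ ℕ =>
      MvPolynomial.coeff d
        (∑ p ∈ Finset.univ.filter
            (fun p : Nat.Partition (d.sum fun _ e => e) =>
              p.parts.card ≤ N ∧ ∀ a ∈ p.parts, Even a),
          schurPoly (Fin N) (partsList p))) :
    (∏ q ∈ Finset.univ.filter (fun q : Fin N × Fin N => q.1 ≤ q.2),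
        ((1 : MvPowerSeries (Fin N) ℂ) -
          MvPowerSeries.X q.1 * MvPowerSeries.X q.2)) * S = 1 := by
  subst hS
  refine IsGradingOf.congr_left ?_ IsGradingOf.one
  rw [← prod_mul_mk_schurPoly N]
  refine (IsGradingOf.prod _ fun q _ => ?_).mul (isGradingOf_sum_schurPoly N)
  have h := IsGradingOf.one.sub ((IsGradingOf.X (R := ℂ) q.1).mul (IsGradingOf.X q.2))
  convert h using 2
  ring
end

section
/- In the polynomial ring ℂ[x^a_t] as above, with D(k) = det P(k), the Laplacian satisfies ∂²_{kk}(D(k)^ℓ) = 2ℓ(m - k + 2ℓ - 1) D(k)^{ℓ-1} D(k-1) for all ℓ ≥ 1, where ∂²_{kk} = ∑_{a=1}^m ∂_{ak}∂_{ak}. -/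
open MvPolynomial

open Matrix in
/-- Determinant of a bordered matrix whose principal block has a cancellable determinant. -/
theorem det_fromBlocks_eq_of_isRegular {n R : Type*} [Fintype n] [DecidableEq n] [CommRing R]
    (A : Matrix n n R) (B : Matrix n (Fin 1) R) (C : Matrix (Fin 1) n R)
    (D : Matrix (Fin 1) (Fin 1) R) (hA : IsRegular A.det) :
    (fromBlocks A B C D).det = (A.det • D - C * A.adjugate * B) 0 0 := by
  have h : fromBlocks A B C D * fromBlocks 1 (-(A.adjugate * B)) 0 (A.det • 1) =
      fromBlocks A 0 C (A.det • D - C * A.adjugate * B) := by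
    rw [fromBlocks_multiply]
    congr 1
    · simp
    · rw [Matrix.mul_neg, ← Matrix.mul_assoc, mul_adjugate]
      simp
    · simp
    · simp [Matrix.mul_assoc, sub_eq_neg_add]
  have h' := congrArg Matrix.det h
  rw [det_mul, det_fromBlocks_zero₂₁, det_fromBlocks_zero₁₂, det_one, one_mul, det_fin_one (A.det • 1),
    det_fin_one, mul_comm] at h'
  refine hA.left ?_
  simpa using h'

open Matrix Polynomial in
/-- Determinant of a bordered matrix in terms of the adjugate of its principal block. -/
theorem det_fromBlocks_fin_one {n R : Type*} [Fintype n] [DecidableEq n] [CommRing R]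
    (A : Matrix n n R) (B : Matrix n (Fin 1) R) (C : Matrix (Fin 1) n R)
    (D : Matrix (Fin 1) (Fin 1) R) :
    (fromBlocks A B C D).det = (A.det • D - C * A.adjugate * B) 0 0 := by
  let A' : Matrix n n R[X] := A.map Polynomial.C + (Polynomial.X : R[X]) • 1
  have hA' : A'.map (evalRingHom (0 : R)) = A := by
    ext i j
    by_cases h : i = j <;> simp [A', h]
  have hreg : IsRegular A'.det := by
    refine Polynomial.Monic.isRegular ?_
    simp only [A', Polynomial.Monic.def, ← Polynomial.leadingCoeff_det_X_one_add_C A, add_comm]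
  have key := congrArg (evalRingHom (0 : R)) (det_fromBlocks_eq_of_isRegular A'
    (B.map Polynomial.C) (C.map Polynomial.C) (D.map Polynomial.C) hreg)
  have hC : (evalRingHom (0 : R) : R[X] → R) ∘ Polynomial.C = id := by
    ext; simp
  rw [RingHom.map_det, RingHom.mapMatrix_apply, fromBlocks_map, hA', Matrix.map_map, Matrix.map_map,
    Matrix.map_map, hC, Matrix.map_id, Matrix.map_id, Matrix.map_id] at key
  rw [key]
  change ((A'.det • D.map Polynomial.C - C.map Polynomial.C * A'.adjugate *
    B.map Polynomial.C).map (evalRingHom (0 : R))) 0 0 = _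
  have hdet : evalRingHom (0 : R) A'.det = A.det := by
    rw [RingHom.map_det, RingHom.mapMatrix_apply, hA']
  have hadj : A'.adjugate.map (evalRingHom (0 : R)) = A.adjugate := by
    rw [← RingHom.mapMatrix_apply, RingHom.map_adjugate, RingHom.mapMatrix_apply, hA']
  rw [Matrix.map_sub _ (map_sub _), Matrix.map_mul, Matrix.map_mul, hadj,
    Matrix.map_smul' _ _ _ (map_mul _), hdet, Matrix.map_map, Matrix.map_map, Matrix.map_map, hC,
    Matrix.map_id, Matrix.map_id, Matrix.map_id]

open Matrix in
/-- The symmetric matrix `det (Yᵀ Y) • 1 - Y adj(Yᵀ Y) Yᵀ`, a multiple of the orthogonal projection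
onto the complement of the column space of `Y`. -/
def gramComplement {m n R : Type*} [Fintype m] [DecidableEq m] [Fintype n] [DecidableEq n]
    [CommRing R] (Y : Matrix m n R) : Matrix m m R :=
  (Yᵀ * Y).det • 1 - Y * (Yᵀ * Y).adjugate * Yᵀ

section gramComplement

open Matrix

variable {m n R : Type*} [Fintype m] [DecidableEq m] [Fintype n] [DecidableEq n] [CommRing R]
  (Y : Matrix m n R)

theorem gramComplement_transpose : (gramComplement Y)ᵀ = gramComplement Y := by
  simp [gramComplement, Matrix.mul_assoc, adjugate_transpose]

theorem gramComplement_mul_self :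
    gramComplement Y * gramComplement Y = (Yᵀ * Y).det • gramComplement Y := by
  have h : gramComplement Y * Y = 0 := by
    rw [gramComplement, Matrix.sub_mul, Matrix.mul_assoc _ Yᵀ, Matrix.mul_assoc Y, adjugate_mul]
    simp
  conv_lhs => enter [2]; rw [gramComplement]
  rw [Matrix.mul_sub, Matrix.mul_assoc Y, ← Matrix.mul_assoc _ Y, h]
  simp

theorem trace_gramComplement :
    (gramComplement Y).trace = ((Fintype.card m : R) - Fintype.card n) * (Yᵀ * Y).det := by
  rw [gramComplement, trace_sub, Matrix.mul_assoc, trace_mul_comm, Matrix.mul_assoc, adjugate_mul]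
  simp
  ring

theorem map_gramComplement {S : Type*} [CommRing S] (f : R →+* S) :
    (gramComplement Y).map f = gramComplement (Y.map f) := by
  have h : Yᵀ.map f * Y.map f = f.mapMatrix (Yᵀ * Y) := by simp [Matrix.map_mul]
  rw [gramComplement, gramComplement, ← transpose_map, h, ← RingHom.map_adjugate, ← RingHom.map_det,
    RingHom.mapMatrix_apply, ← Matrix.map_mul, ← Matrix.map_mul]
  ext i j
  by_cases hij : i = j <;> simp [hij, -Matrix.map_mul]

/-- Appending a column `v` to `Y` turns the Gram determinant into a quadratic form in `v`. -/
theorem det_gram_snoc {n : ℕ} (Y : Matrix m (Fin (n + 1)) R) :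
    (Yᵀ * Y).det = Y.col (Fin.last n) ⬝ᵥ
      gramComplement (Y.submatrix id Fin.castSucc) *ᵥ Y.col (Fin.last n) := by
  set Z := Y.submatrix id Fin.castSucc with hZ
  set V : Matrix m (Fin 1) R := replicateCol (Fin 1) (Y.col (Fin.last n)) with hV
  have h : (Yᵀ * Y).submatrix finSumFinEquiv finSumFinEquiv =
      fromBlocks (Zᵀ * Z) (Zᵀ * V) (Vᵀ * Z) (Vᵀ * V) := by
    have hl (j : Fin 1) : Fin.natAdd n j = Fin.last n := by
      ext; simp
    ext (i | i) (j | j) <;>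
      simp [Matrix.mul_apply, hZ, hV, hl, Fin.castSucc]
  rw [← det_submatrix_equiv_self finSumFinEquiv, h, det_fromBlocks_fin_one]
  have e : (Zᵀ * Z).det • (Vᵀ * V) - Vᵀ * Z * (Zᵀ * Z).adjugate * (Zᵀ * V) =
      Vᵀ * (gramComplement Z * V) := by
    simp [gramComplement, Matrix.mul_sub, Matrix.sub_mul, Matrix.mul_assoc]
  rw [e]
  simp [Matrix.mul_apply, dotProduct, mulVec, hV]

end gramComplement

open Matrix in
/-- The Laplacian of a power of a quadratic form whose matrix `Q` is constant and satisfies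
`Q ^ 2 = c Q`. -/
theorem sum_derivation_sq_pow_quadForm {R A ι : Type*} [CommRing R] [CommRing A] [Algebra R A]
    [Fintype ι] [DecidableEq ι] (d : ι → Derivation R A A) (v : ι → A) (Q : Matrix ι ι A) (c : A)
    (hv : ∀ a b, d a (v b) = if a = b then 1 else 0) (hQ : ∀ a i j, d a (Q i j) = 0)
    (hT : Qᵀ = Q) (hQQ : Q * Q = c • Q) (l : ℕ) :
    ∑ a, d a (d a ((v ⬝ᵥ Q *ᵥ v) ^ (l + 1))) =
      2 * (l + 1) * (v ⬝ᵥ Q *ᵥ v) ^ l * (Q.trace + 2 * l * c) := by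
  set D := v ⬝ᵥ Q *ᵥ v with hD
  have h1 (a i) : d a ((Q *ᵥ v) i) = Q i a := by
    simp [mulVec, dotProduct, map_sum, hv, hQ]
  have h2 (a) : d a D = 2 * (Q *ᵥ v) a := by
    have : ∑ i, v i * Q i a = (Q *ᵥ v) a := by
      conv_rhs => rw [← hT]
      simp [mulVec, dotProduct, mul_comm]
    simp only [hD, dotProduct, map_sum, Derivation.leibniz, smul_eq_mul, h1, hv,
      Finset.sum_add_distrib, this]
    simp
    ring
  have h3 (a) : d a (d a (D ^ (l + 1))) =
      2 * (l + 1) * D ^ l * Q a a + 4 * ((l + 1) * l * D ^ (l - 1)) * ((Q *ᵥ v) a * (Q *ᵥ v) a) := by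
    have h2' : d a (2 : A) = 0 := by simpa using (d a).map_natCast 2
    simp [Derivation.leibniz_pow, Derivation.leibniz, h2, h1, h2', nsmul_eq_mul]
    ring
  have h4 : ∑ a, (Q *ᵥ v) a * (Q *ᵥ v) a = c * D := by
    change (Q *ᵥ v) ⬝ᵥ (Q *ᵥ v) = _
    rw [dotProduct_mulVec, ← mulVec_transpose, hT, mulVec_mulVec, hQQ, dotProduct_comm, smul_mulVec,
      dotProduct_smul, smul_eq_mul]
  simp_rw [h3]
  rw [Finset.sum_add_distrib, ← Finset.mul_sum, ← Finset.mul_sum, h4]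
  change _ * Q.trace + _ = _
  cases l with
  | zero => simp
  | succ l => simp [pow_succ]; ring

/-- In `ℂ[x^a_t]`, with `D(k) = det P(k)` the Gram determinant and
`∂²_{kk} = ∑_a ∂_{ak}∂_{ak}` the Laplacian, one has
`∂²_{kk}(D(k)^ℓ) = 2ℓ(m - k + 2ℓ - 1) D(k)^{ℓ-1} D(k-1)` for all `ℓ ≥ 1`. -/
theorem laplacian_of_gram_det_power (m N k : ℕ) (hk1 : 1 ≤ k) (hkN : k ≤ N)
    (p : Fin N → Fin N → MvPolynomial (Fin m × Fin N) ℂ)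
    (hp : ∀ t s : Fin N, p t s = ∑ a : Fin m, X (a, t) * X (a, s))
    (Dk Dk1 : MvPolynomial (Fin m × Fin N) ℂ)
    (hDk : Dk = Matrix.det
      (Matrix.of fun i j : Fin k => p (Fin.castLE hkN i) (Fin.castLE hkN j)))
    (hDk1 : Dk1 = Matrix.det
      (Matrix.of fun i j : Fin (k - 1) =>
        p (Fin.castLE (by omega) i) (Fin.castLE (by omega) j)))
    (kc : Fin N) (hkc : (kc : ℕ) = k - 1) :
    ∀ ℓ : ℕ, 1 ≤ ℓ →
      (∑ a : Fin m, pderiv (a, kc) (pderiv (a, kc) (Dk ^ ℓ))) =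
        (((2 * (ℓ : ℤ) * ((m : ℤ) - (k : ℤ) + 2 * (ℓ : ℤ) - 1)) : ℤ) :
            MvPolynomial (Fin m × Fin N) ℂ) * (Dk ^ (ℓ - 1) * Dk1) := by
  obtain ⟨n, rfl⟩ : ∃ n, k = n + 1 := ⟨k - 1, by omega⟩
  simp only [Nat.add_sub_cancel] at hDk1 hkc
  have hkc' : kc = Fin.castLE hkN (Fin.last n) := by ext; simp [hkc]
  rintro ℓ hℓ
  obtain ⟨l, rfl⟩ : ∃ l, ℓ = l + 1 := ⟨ℓ - 1, by omega⟩
  let Y : Matrix (Fin m) (Fin (n + 1)) (MvPolynomial (Fin m × Fin N) ℂ) :=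
    .of fun a i => X (a, Fin.castLE hkN i)
  let Z₀ : Matrix (Fin m) (Fin n) (MvPolynomial (Fin m × Fin n) ℂ) := .of fun a i => X (a, i)
  let g : Fin m × Fin n → Fin m × Fin N := Prod.map id (Fin.castLE (by omega))
  let f : MvPolynomial (Fin m × Fin n) ℂ →+* MvPolynomial (Fin m × Fin N) ℂ := (rename g).toRingHom
  have hf (a : Fin m) (q) : pderiv (a, kc) (f q) = 0 := by
    refine pderiv_eq_zero_of_notMem_vars fun h => ?_
    classical
    obtain ⟨x, -, hx⟩ := Finset.mem_image.mp (vars_rename g q h)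
    have := congrArg (fun y : Fin m × Fin N => (y.2 : ℕ)) hx
    simp [g, hkc] at this
    omega
  have hZ : Y.submatrix id Fin.castSucc = Z₀.map f := by
    ext1 a i
    simp [Y, Z₀, f, g]
  have hD : Dk = Y.col (Fin.last n) ⬝ᵥ
      (gramComplement (Z₀.map f)).mulVec (Y.col (Fin.last n)) := by
    rw [← hZ, ← det_gram_snoc, hDk]
    congr 1
    ext1 i j
    simp [hp, Y, Matrix.mul_apply]
  have hD1 : Dk1 = ((Z₀.map f).transpose * Z₀.map f).det := by
    rw [hDk1, ← hZ]
    congr 1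
    ext1 i j
    simp [hp, Y, Matrix.mul_apply]
  have key := sum_derivation_sq_pow_quadForm (fun a : Fin m => pderiv (R := ℂ) (a, kc))
    (Y.col (Fin.last n)) (gramComplement (Z₀.map f)) _
    (fun a b => by simp [Y, hkc', Pi.single_apply, eq_comm])
    (fun a i j => by rw [← map_gramComplement]; exact hf a _)
    (gramComplement_transpose _) (gramComplement_mul_self _) l
  rw [← hD, trace_gramComplement, ← hD1] at key
  rw [key]
  simp
  ring
end
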